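/- (Macdonald difference operators and the geometric specialization.) Fix q ∈ (0,1), integers N ≥ 1, 1 ≤ n ≤ N, k ≥ 1 and α ∈ (0,1). Let x ∈ ℂ^N satisfy q^a x_i ≠ q^b x_j for all 1 ≤ i < j ≤ N and 0 ≤ a, b ≤ k, and α q^a x_i ≠ q^{−m} for all 1 ≤ i ≤ n, 0 ≤ a ≤ k and all integers m ≥ 0 (so the infinite products below are nonzero). Set G(x) = ∏_{i=1}^{n} 1/(α x_i; q)_∞. Then for every function F : ℂ^N → ℂ: ((D_n)^k (G·F))(x) = G(x) · (Ã^{(−α x_n, k)}_n F)(x), where in Ã^{(−α x_n, k)}_n the parameter −α x_n is evaluated at the unshifted point x. -/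

import Mathlib

/-- The complex q-Pochhammer symbol `(a;q)_n = ∏_{i=0}^{n-1} (1 - a q^i)`. -/
noncomputable def qPochC (q : ℝ) (a : ℂ) (n : ℕ) : ℂ := ∏ i ∈ Finset.range n, (1 - a * (q : ℂ) ^ i)

/-- The complex infinite q-Pochhammer symbol `(a;q)_∞`. -/
noncomputable def qPochInfC (q : ℝ) (a : ℂ) : ℂ := ∏' i : ℕ, (1 - a * (q : ℂ) ^ i)

/-- The coefficients `C_a(k,s) = (-a)^s (-a;q)_{k-s} (q;q)_k / ((q;q)_{k-s} (q;q)_s)`. -/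
noncomputable def CcoC (q : ℝ) (a : ℂ) (k s : ℕ) : ℂ :=
  (-a) ^ s * qPochC q (-a) (k - s) *
    (qPochC q (q : ℂ) k / (qPochC q (q : ℂ) (k - s) * qPochC q (q : ℂ) s))

/-- The `t = 0` Macdonald first difference operator
`(D_n F)(x) = ∑_{i=1}^{n} (∏_{j≤n, j≠i} (-x_j)/(x_i - x_j)) F(x_1,…,q x_i,…,x_N)`;
`n = 0` gives the zero operator. -/
noncomputable def Dop {N : ℕ} (q : ℝ) (n : ℕ) (F : (Fin N → ℂ) → ℂ) (x : Fin N → ℂ) : ℂ :=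
  ∑ i ∈ Finset.univ.filter (fun i : Fin N => (i : ℕ) < n),
    (∏ j ∈ Finset.univ.filter (fun j : Fin N => (j : ℕ) < n ∧ j ≠ i), (-(x j)) / (x i - x j))
      * F (Function.update x i ((q : ℂ) * x i))

/-- `(Ã^{(a,k)}_n F)(x) = ∑_{s=0}^{k} C_a(k,s) ((D_{n-1})^s (D_n)^{k-s} F)(x)`. -/
noncomputable def Atilde {N : ℕ} (q : ℝ) (a : ℂ) (n k : ℕ) (F : (Fin N → ℂ) → ℂ)
    (x : Fin N → ℂ) : ℂ :=
  ∑ s ∈ Finset.range (k + 1), CcoC q a k s * ((Dop q (n - 1))^[s] ((Dop q n)^[k - s] F)) x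

/-- The coefficient of the shift of `x i` in `Dop q n`. -/
noncomputable def dopCoeff {N : ℕ} (n : ℕ) (i : Fin N) (x : Fin N → ℂ) : ℂ :=
  ∏ j ∈ Finset.univ.filter (fun j : Fin N => (j : ℕ) < n ∧ j ≠ i), (-(x j)) / (x i - x j)

/-- The operator `Dop q n` with the `i`-th summand weighted by `x i`. -/
noncomputable def weightedDop {N : ℕ} (q : ℝ) (n : ℕ) (F : (Fin N → ℂ) → ℂ) (x : Fin N → ℂ) : ℂ :=
  ∑ i ∈ Finset.univ.filter (fun i : Fin N => (i : ℕ) < n),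
    dopCoeff n i x * (x i * F (Function.update x i ((q : ℂ) * x i)))

/-- The conjugate of `Dop q n` by `∏ i, 1 / (α x_i; q)_∞`. -/
noncomputable def conjDop {N : ℕ} (q : ℝ) (α : ℂ) (n : ℕ) (F : (Fin N → ℂ) → ℂ)
    (x : Fin N → ℂ) : ℂ :=
  Dop q n F x - α * weightedDop q n F x

/-- The coordinates of `x` stay pairwise distinct when each is scaled by `q` at most `r` times. -/
def QSeparated {N : ℕ} (q : ℝ) (r : ℕ) (x : Fin N → ℂ) : Prop :=
  ∀ i j : Fin N, i ≠ j → ∀ A B : ℕ, A ≤ r → B ≤ r → (q : ℂ) ^ A * x i ≠ (q : ℂ) ^ B * x j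

section

variable {N : ℕ} {q : ℝ}

lemma Dop_eq_sum (n : ℕ) (F : (Fin N → ℂ) → ℂ) (x : Fin N → ℂ) :
    Dop q n F x = ∑ i ∈ Finset.univ.filter (fun i : Fin N => (i : ℕ) < n),
      dopCoeff n i x * F (Function.update x i ((q : ℂ) * x i)) := rfl

lemma QSeparated.mono {r r' : ℕ} {x : Fin N → ℂ} (h : QSeparated q r x) (hr : r' ≤ r) :
    QSeparated q r' x :=
  fun i j hij A B hA hB => h i j hij A B (hA.trans hr) (hB.trans hr)

lemma QSeparated.update {r : ℕ} {x : Fin N → ℂ} (h : QSeparated q (r + 1) x) (i : Fin N) :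
    QSeparated q r (Function.update x i ((q : ℂ) * x i)) := by
  intro a b hab A B hA hB
  by_cases ha : a = i
  · subst ha
    rw [Function.update_self, Function.update_of_ne hab.symm, ← mul_assoc, ← pow_succ]
    exact h a b hab _ _ (by omega) (by omega)
  · by_cases hb : b = i
    · subst hb
      rw [Function.update_self, Function.update_of_ne hab, ← mul_assoc, ← pow_succ]
      exact h a b hab _ _ (by omega) (by omega)
    · rw [Function.update_of_ne ha, Function.update_of_ne hb]
      exact h a b hab _ _ (by omega) (by omega)

lemma QSeparated.ne {r : ℕ} {x : Fin N → ℂ} (h : QSeparated q r x) {i j : Fin N} (hij : i ≠ j) :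
    x i ≠ x j := by
  simpa using h i j hij 0 0 (Nat.zero_le _) (Nat.zero_le _)

lemma Dop_congr_of_qSeparated {r n : ℕ} {F G : (Fin N → ℂ) → ℂ}
    (h : ∀ x, QSeparated q r x → F x = G x) {x : Fin N → ℂ} (hx : QSeparated q (r + 1) x) :
    Dop q n F x = Dop q n G x := by
  simp only [Dop_eq_sum]
  exact Finset.sum_congr rfl fun i _ => by rw [h _ (hx.update i)]

lemma iterate_Dop_congr_of_qSeparated {r n : ℕ} {F G : (Fin N → ℂ) → ℂ}
    (h : ∀ x, QSeparated q r x → F x = G x) (s : ℕ) :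
    ∀ x, QSeparated q (r + s) x → (Dop q n)^[s] F x = (Dop q n)^[s] G x := by
  induction s with
  | zero => exact h
  | succ s ih =>
    intro x hx
    rw [Function.iterate_succ_apply', Function.iterate_succ_apply']
    exact Dop_congr_of_qSeparated ih hx

lemma Dop_sub_const_mul (n : ℕ) (c : ℂ) (F G : (Fin N → ℂ) → ℂ) :
    Dop q n (fun w => F w - c * G w) = fun w => Dop q n F w - c * Dop q n G w := by
  funext x
  simp only [Dop_eq_sum, Finset.mul_sum, ← Finset.sum_sub_distrib]
  exact Finset.sum_congr rfl fun i _ => by ring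

lemma iterate_Dop_sub_const_mul (n : ℕ) (c : ℂ) (F G : (Fin N → ℂ) → ℂ) (s : ℕ) :
    (Dop q n)^[s] (fun w => F w - c * G w) =
      fun w => (Dop q n)^[s] F w - c * (Dop q n)^[s] G w := by
  induction s with
  | zero => rfl
  | succ s ih => simp only [Function.iterate_succ_apply', ih, Dop_sub_const_mul]

/-- `Dop q n` is linear over functions of a coordinate that it does not shift. -/
lemma iterate_Dop_mul_add_mul (n : ℕ) (l : Fin N) (hl : n ≤ (l : ℕ)) (f g : ℂ → ℂ)
    (F G : (Fin N → ℂ) → ℂ) (s : ℕ) :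
    (Dop q n)^[s] (fun w => f (w l) * F w + g (w l) * G w) =
      fun w => f (w l) * (Dop q n)^[s] F w + g (w l) * (Dop q n)^[s] G w := by
  induction s with
  | zero => rfl
  | succ s ih =>
    simp only [Function.iterate_succ_apply', ih]
    funext x
    simp only [Dop_eq_sum, Finset.mul_sum, ← Finset.sum_add_distrib]
    refine Finset.sum_congr rfl fun i hi => ?_
    have hli : l ≠ i := by
      rintro rfl
      have := (Finset.mem_filter.mp hi).2
      omega
    rw [Function.update_of_ne hli]
    ring

lemma dopCoeff_eq_mul (n : ℕ) {i j : Fin N} (hj : (j : ℕ) < n) (hij : i ≠ j) (x : Fin N → ℂ) :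
    dopCoeff n i x = (-(x j)) / (x i - x j) *
      ∏ l ∈ Finset.univ.filter (fun l : Fin N => (l : ℕ) < n ∧ l ≠ i ∧ l ≠ j),
        (-(x l)) / (x i - x l) := by
  rw [dopCoeff, ← Finset.mul_prod_erase _ _
    (show j ∈ Finset.univ.filter (fun j : Fin N => (j : ℕ) < n ∧ j ≠ i) by
      simp [hj, hij.symm])]
  congr 2
  ext l
  simp only [Finset.mem_erase, Finset.mem_filter, Finset.mem_univ, true_and]
  tauto

lemma dopCoeff_mul_dopCoeff_update {n : ℕ} {i j : Fin N} (hi : (i : ℕ) < n) (hj : (j : ℕ) < n)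
    (hij : i ≠ j) {x : Fin N → ℂ} (hx : QSeparated q 1 x) :
    dopCoeff n i x * dopCoeff n j (Function.update x i ((q : ℂ) * x i)) * (x j - q * x i) =
      (q * x i * x j) / (x i - x j) *
      ((∏ l ∈ Finset.univ.filter (fun l : Fin N => (l : ℕ) < n ∧ l ≠ i ∧ l ≠ j),
        (-(x l)) / (x i - x l)) *
      ∏ l ∈ Finset.univ.filter (fun l : Fin N => (l : ℕ) < n ∧ l ≠ j ∧ l ≠ i),
        (-(x l)) / (x j - x l)) := by
  have h1 : x j - q * x i ≠ 0 := by
    have := hx i j hij 1 0 le_rfl (Nat.zero_le _)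
    rw [sub_ne_zero]
    intro h
    apply this
    simp [h]
  have h2 : x i - x j ≠ 0 := sub_ne_zero.mpr (hx.ne hij)
  rw [dopCoeff_eq_mul n hj hij, dopCoeff_eq_mul n hi hij.symm, Function.update_self,
    Function.update_of_ne hij.symm]
  have h3 : ∏ l ∈ Finset.univ.filter (fun l : Fin N => (l : ℕ) < n ∧ l ≠ j ∧ l ≠ i),
        (-(Function.update x i ((q : ℂ) * x i) l)) /
          (x j - Function.update x i ((q : ℂ) * x i) l) =
      ∏ l ∈ Finset.univ.filter (fun l : Fin N => (l : ℕ) < n ∧ l ≠ j ∧ l ≠ i),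
        (-(x l)) / (x j - x l) := by
    refine Finset.prod_congr rfl fun l hl => ?_
    rw [Function.update_of_ne (Finset.mem_filter.mp hl).2.2.2]
  rw [h3, div_mul_eq_mul_div, div_mul_eq_mul_div (-((q : ℂ) * x i)), div_mul_div_comm,
    div_mul_eq_mul_div, div_mul_eq_mul_div, div_eq_div_iff (mul_ne_zero h2 h1) h2]
  ring

lemma Dop_weightedDop {n : ℕ} (F : (Fin N → ℂ) → ℂ) {x : Fin N → ℂ} (hx : QSeparated q 1 x) :
    Dop q n (weightedDop q n F) x = q * weightedDop q n (Dop q n F) x := by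
  set S := Finset.univ.filter (fun i : Fin N => (i : ℕ) < n) with hS
  let T : Fin N → (Fin N → ℂ) → (Fin N → ℂ) := fun i w => Function.update w i ((q : ℂ) * w i)
  let W : Fin N → Fin N → ℂ := fun i j =>
    dopCoeff n i x * dopCoeff n j (T i x) * (T i x j - q * x i) * F (T j (T i x))
  have hanti : ∀ i ∈ S, ∀ j ∈ S, W i j = -W j i := by
    intro i hi j hj
    by_cases hij : i = j
    · subst hij
      simp [W, T]
    · have hi' : (i : ℕ) < n := (Finset.mem_filter.mp hi).2
      have hj' : (j : ℕ) < n := (Finset.mem_filter.mp hj).2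
      have hT : T j (T i x) = T i (T j x) := by
        simp only [T, Function.update_of_ne hij, Function.update_of_ne (Ne.symm hij)]
        exact Function.update_comm hij _ _ _
      have hTi : T i x j = x j := Function.update_of_ne (Ne.symm hij) _ _
      have hTj : T j x i = x i := Function.update_of_ne hij _ _
      simp only [W, hT, hTi, hTj]
      rw [dopCoeff_mul_dopCoeff_update hi' hj' hij hx,
        dopCoeff_mul_dopCoeff_update hj' hi' (Ne.symm hij) hx,
        ← neg_sub (x i) (x j), div_neg]
      ring
  have hzero : ∑ i ∈ S, ∑ j ∈ S, W i j = 0 := by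
    have h : ∑ i ∈ S, ∑ j ∈ S, W i j = -∑ i ∈ S, ∑ j ∈ S, W i j := by
      conv_rhs => rw [Finset.sum_comm]
      simp only [← Finset.sum_neg_distrib]
      exact Finset.sum_congr rfl fun i hi => Finset.sum_congr rfl fun j hj => hanti i hi j hj
    exact self_eq_neg.mp h
  rw [← sub_eq_zero, ← hzero]
  simp only [Dop_eq_sum, weightedDop, Finset.mul_sum, ← Finset.sum_sub_distrib]
  refine Finset.sum_congr rfl fun i _ => Finset.sum_congr rfl fun j _ => ?_
  simp only [W, T]
  ring

lemma iterate_Dop_weightedDop {n : ℕ} (F : (Fin N → ℂ) → ℂ) (m : ℕ) :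
    ∀ x, QSeparated q m x → (Dop q n)^[m] (weightedDop q n F) x =
      (q : ℂ) ^ m * weightedDop q n ((Dop q n)^[m] F) x := by
  induction m with
  | zero => simp
  | succ m ih =>
    intro x hx
    have h := Dop_congr_of_qSeparated (n := n) ih hx
    have hsmul : ∀ G : (Fin N → ℂ) → ℂ,
        Dop q n (fun w => (q : ℂ) ^ m * G w) x = (q : ℂ) ^ m * Dop q n G x := by
      intro G
      simp only [Dop_eq_sum, Finset.mul_sum]
      exact Finset.sum_congr rfl fun i _ => by ring
    rw [Function.iterate_succ_apply', h, hsmul, Dop_weightedDop _ (hx.mono (by omega)),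
      Function.iterate_succ_apply']
    ring

lemma weightedDop_eq {n : ℕ} (l : Fin N) (hl : (l : ℕ) + 1 = n) (F : (Fin N → ℂ) → ℂ)
    {x : Fin N → ℂ} (hx : QSeparated q 0 x) :
    weightedDop q n F x = x l * (Dop q n F x - Dop q (n - 1) F x) := by
  have hS : Finset.univ.filter (fun i : Fin N => (i : ℕ) < n) =
      insert l (Finset.univ.filter (fun i : Fin N => (i : ℕ) < n - 1)) := by
    ext i
    simp only [Finset.mem_filter, Finset.mem_univ, true_and, Finset.mem_insert, Fin.ext_iff]
    omega
  have hmem : l ∉ Finset.univ.filter (fun i : Fin N => (i : ℕ) < n - 1) := by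
    simp only [Finset.mem_filter, Finset.mem_univ, true_and]
    omega
  simp only [weightedDop, Dop_eq_sum]
  rw [hS, Finset.sum_insert hmem, Finset.sum_insert hmem, add_sub_assoc, mul_add,
    ← Finset.sum_sub_distrib, Finset.mul_sum]
  congr 1
  · ring
  refine Finset.sum_congr rfl fun i hi => ?_
  have hi' : (i : ℕ) < n - 1 := (Finset.mem_filter.mp hi).2
  have hil : i ≠ l := by
    rintro rfl
    omega
  have h0 : x i - x l ≠ 0 := sub_ne_zero.mpr (hx.ne hil)
  have hc : dopCoeff n i x = (-(x l)) / (x i - x l) * dopCoeff (n - 1) i x := by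
    rw [dopCoeff_eq_mul n (by omega) hil, dopCoeff]
    congr 2
    ext j
    simp only [Finset.mem_filter, Finset.mem_univ, true_and, ne_eq, Fin.ext_iff]
    omega
  rw [hc]
  field_simp
  ring

lemma qPochC_succ (a : ℂ) (n : ℕ) : qPochC q a (n + 1) = qPochC q a n * (1 - a * (q : ℂ) ^ n) :=
  Finset.prod_range_succ _ _

lemma qPochC_self_ne_zero (hq : q ∈ Set.Ioo (0 : ℝ) 1) (n : ℕ) : qPochC q (q : ℂ) n ≠ 0 := by
  refine Finset.prod_ne_zero_iff.mpr fun i _ => ?_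
  rw [← pow_succ', sub_ne_zero]
  exact_mod_cast (pow_lt_one₀ hq.1.le hq.2 (Nat.succ_ne_zero i)).ne'

lemma CcoC_zero_right (hq : q ∈ Set.Ioo (0 : ℝ) 1) (a : ℂ) (k : ℕ) :
    CcoC q a k 0 = qPochC q (-a) k := by
  have h := qPochC_self_ne_zero hq k
  simp [CcoC, show qPochC q (q : ℂ) 0 = 1 from rfl, h]

lemma CcoC_self (hq : q ∈ Set.Ioo (0 : ℝ) 1) (a : ℂ) (k : ℕ) : CcoC q a k k = (-a) ^ k := by
  have h := qPochC_self_ne_zero hq k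
  simp [CcoC, show ∀ b, qPochC q b 0 = 1 from fun _ => rfl, h]

lemma CcoC_succ_succ (hq : q ∈ Set.Ioo (0 : ℝ) 1) (y : ℂ) {k s : ℕ} (hs : s < k) :
    CcoC q (-y) (k + 1) (s + 1) =
      CcoC q (-y) k (s + 1) * (1 - y * (q : ℂ) ^ (k - (s + 1))) +
        CcoC q (-y) k s * (y * (q : ℂ) ^ (k - s)) := by
  obtain ⟨r, rfl⟩ := Nat.exists_eq_add_of_lt hs
  have e1 : s + r + 1 + 1 - (s + 1) = r + 1 := by omega
  have e2 : s + r + 1 - (s + 1) = r := by omega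
  have e3 : s + r + 1 - s = r + 1 := by omega
  have h1 := qPochC_self_ne_zero hq r
  have h2 := qPochC_self_ne_zero hq s
  have h3 := qPochC_self_ne_zero hq (r + 1)
  have h4 := qPochC_self_ne_zero hq (s + 1)
  simp only [CcoC, e1, e2, e3, neg_neg]
  rw [qPochC_succ (q : ℂ) (s + r + 1)]
  rw [qPochC_succ] at h3 h4
  rw [qPochC_succ (q : ℂ) r, qPochC_succ (q : ℂ) s, qPochC_succ y r]
  have h5 := right_ne_zero_of_mul h3
  have h6 := right_ne_zero_of_mul h4
  simp only [pow_add, pow_one] at h5 h6 ⊢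
  generalize (q : ℂ) ^ r = u at *
  generalize (q : ℂ) ^ s = v at *
  rw [mul_comm (q : ℂ)] at h5
  field_simp
  ring

lemma sum_CcoC_succ (hq : q ∈ Set.Ioo (0 : ℝ) 1) (y : ℂ) (k : ℕ) (a : ℕ → ℂ) :
    ∑ s ∈ Finset.range (k + 2), CcoC q (-y) (k + 1) s * a s =
      ∑ s ∈ Finset.range (k + 1), CcoC q (-y) k s *
        ((1 - y * (q : ℂ) ^ (k - s)) * a s + y * (q : ℂ) ^ (k - s) * a (s + 1)) := by
  simp only [mul_add, Finset.sum_add_distrib]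
  rw [Finset.sum_range_succ, Finset.sum_range_succ', Finset.sum_range_succ' _ k,
    Finset.sum_range_succ (fun s => CcoC q (-y) k s * (y * (q : ℂ) ^ (k - s) * a (s + 1))) k]
  have h : ∑ s ∈ Finset.range k, CcoC q (-y) (k + 1) (s + 1) * a (s + 1) =
      ∑ s ∈ Finset.range k,
        CcoC q (-y) k (s + 1) * ((1 - y * (q : ℂ) ^ (k - (s + 1))) * a (s + 1)) +
      ∑ s ∈ Finset.range k, CcoC q (-y) k s * (y * (q : ℂ) ^ (k - s) * a (s + 1)) := by
    rw [← Finset.sum_add_distrib]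
    refine Finset.sum_congr rfl fun s hs => ?_
    rw [CcoC_succ_succ hq y (Finset.mem_range.mp hs)]
    ring
  rw [h, CcoC_self hq, CcoC_self hq, CcoC_zero_right hq, CcoC_zero_right hq, neg_neg, qPochC_succ]
  simp only [Nat.sub_zero, Nat.sub_self]
  ring

lemma iterate_Dop_conjDop {n : ℕ} (l : Fin N) (hl : (l : ℕ) + 1 = n) (α : ℂ)
    (F : (Fin N → ℂ) → ℂ) (m : ℕ) (x : Fin N → ℂ) (hx : QSeparated q m x) :
    (Dop q n)^[m] (conjDop q α n F) x =
      (1 - α * x l * (q : ℂ) ^ m) * (Dop q n)^[m + 1] F x +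
        α * x l * (q : ℂ) ^ m * Dop q (n - 1) ((Dop q n)^[m] F) x := by
  have h : conjDop q α n F = fun w => Dop q n F w - α * weightedDop q n F w := rfl
  rw [h, iterate_Dop_sub_const_mul]
  beta_reduce
  rw [iterate_Dop_weightedDop F m x hx,
    weightedDop_eq l hl _ (hx.mono (Nat.zero_le _)), ← Function.iterate_succ_apply,
    ← Function.iterate_succ_apply' (Dop q n)]
  ring

lemma iterate_conjDop (hq : q ∈ Set.Ioo (0 : ℝ) 1) {n : ℕ} (l : Fin N) (hl : (l : ℕ) + 1 = n)
    (α : ℂ) (k : ℕ) :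
    ∀ (F : (Fin N → ℂ) → ℂ) (x : Fin N → ℂ), QSeparated q k x →
      (conjDop q α n)^[k] F x = Atilde q (-(α * x l)) n k F x := by
  induction k with
  | zero =>
    intro F x _
    simp [Atilde, CcoC_self hq]
  | succ k ih =>
    intro F x hx
    rw [Function.iterate_succ_apply, ih _ x (hx.mono (by omega)), Atilde, Atilde,
      sum_CcoC_succ hq (α * x l) k
        (fun s => (Dop q (n - 1))^[s] ((Dop q n)^[k + 1 - s] F) x)]
    refine Finset.sum_congr rfl fun s hs => ?_
    have hsk : s ≤ k := Nat.lt_succ_iff.mp (Finset.mem_range.mp hs)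
    have h := iterate_Dop_congr_of_qSeparated (n := n - 1)
      (iterate_Dop_conjDop l hl α F (k - s)) s x (hx.mono (by omega))
    rw [h, iterate_Dop_mul_add_mul (n - 1) l (by omega)
      (fun z => 1 - α * z * (q : ℂ) ^ (k - s)) (fun z => α * z * (q : ℂ) ^ (k - s)),
      ← Function.iterate_succ_apply, show k + 1 - s = k - s + 1 by omega,
      show k + 1 - (s + 1) = k - s by omega]

lemma qPochInfC_eq_mul (hq : q ∈ Set.Ioo (0 : ℝ) 1) (a : ℂ) :
    qPochInfC q a = (1 - a) * qPochInfC q (q * a) := by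
  have hs : ∀ b : ℂ, Multipliable fun i : ℕ => 1 - b * (q : ℂ) ^ i := by
    intro b
    have hsum : Summable fun i : ℕ => ‖-(b * (q : ℂ) ^ i)‖ := by
      have hnorm : ‖(q : ℂ)‖ < 1 := by
        rw [Complex.norm_real, Real.norm_of_nonneg hq.1.le]
        exact hq.2
      simpa using (summable_geometric_of_lt_one (norm_nonneg _) hnorm).mul_left ‖b‖
    simpa [sub_eq_add_neg] using multipliable_one_add_of_summable hsum
  have hshift : (fun i : ℕ => 1 - a * (q : ℂ) ^ (i + 1)) =
      fun i : ℕ => 1 - q * a * (q : ℂ) ^ i := by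
    funext i
    ring
  rw [qPochInfC, qPochInfC, tprod_eq_zero_mul' (by rw [hshift]; exact hs _), hshift]
  simp

lemma iterate_Dop_prod_inv_qPochInfC_mul (hq : q ∈ Set.Ioo (0 : ℝ) 1) (α : ℂ) (n : ℕ)
    (F : (Fin N → ℂ) → ℂ) (k : ℕ) :
    ∀ x : Fin N → ℂ, (∀ i : Fin N, (i : ℕ) < n → ∀ m : ℕ, (q : ℂ) ^ m * (α * x i) ≠ 1) →
      (Dop q n)^[k]
        (fun w => (∏ i ∈ Finset.univ.filter (fun i : Fin N => (i : ℕ) < n),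
          (qPochInfC q (α * w i))⁻¹) * F w) x =
      (∏ i ∈ Finset.univ.filter (fun i : Fin N => (i : ℕ) < n),
        (qPochInfC q (α * x i))⁻¹) * (conjDop q α n)^[k] F x := by
  induction k with
  | zero => exact fun _ _ => rfl
  | succ k ih =>
    intro x hx
    rw [Function.iterate_succ_apply', Function.iterate_succ_apply', conjDop, weightedDop]
    simp only [Dop_eq_sum, Finset.mul_sum, ← Finset.sum_sub_distrib]
    refine Finset.sum_congr rfl fun i hi => ?_
    rw [ih]
    · have h1 : 1 - α * x i ≠ 0 := by
        have := hx i (Finset.mem_filter.mp hi).2 0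
        rw [pow_zero, one_mul] at this
        exact sub_ne_zero.mpr this.symm
      rw [← Finset.mul_prod_erase _ _ hi, ← Finset.mul_prod_erase _ (fun i =>
        (qPochInfC q (α * x i))⁻¹) hi, Function.update_self, qPochInfC_eq_mul hq (α * x i),
        mul_left_comm α (q : ℂ)]
      have h2 : ∏ j ∈ (Finset.univ.filter (fun i : Fin N => (i : ℕ) < n)).erase i,
            (qPochInfC q (α * Function.update x i ((q : ℂ) * x i) j))⁻¹ =
          ∏ j ∈ (Finset.univ.filter (fun i : Fin N => (i : ℕ) < n)).erase i,
            (qPochInfC q (α * x j))⁻¹ :=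
        Finset.prod_congr rfl fun j hj => by
          rw [Function.update_of_ne (Finset.ne_of_mem_erase hj)]
      rw [h2, mul_inv]
      linear_combination (-dopCoeff n i x * (qPochInfC q (q * (α * x i)))⁻¹ *
        (∏ j ∈ (Finset.univ.filter (fun i : Fin N => (i : ℕ) < n)).erase i,
            (qPochInfC q (α * x j))⁻¹) *
        (conjDop q α n)^[k] F (Function.update x i ((q : ℂ) * x i))) * mul_inv_cancel₀ h1
    · intro j hj m
      by_cases hji : j = i
      · subst hji
        rw [Function.update_self, mul_left_comm α, ← mul_assoc, ← pow_succ]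
        exact hx j hj (m + 1)
      · rw [Function.update_of_ne hji]
        exact hx j hj m

end

theorem stmt_16 (q : ℝ) (hq : q ∈ Set.Ioo (0:ℝ) 1) (N : ℕ) (hN : 1 ≤ N)
    (n : ℕ) (hn1 : 1 ≤ n) (hnN : n ≤ N) (k : ℕ) (hk : 1 ≤ k)
    (α : ℝ) (hα : α ∈ Set.Ioo (0:ℝ) 1)
    (x : Fin N → ℂ)
    (hx : ∀ i j : Fin N, i < j → ∀ A B : ℕ, A ≤ k → B ≤ k →
      (q : ℂ) ^ A * x i ≠ (q : ℂ) ^ B * x j)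
    (hne : ∀ i : Fin N, (i : ℕ) < n → ∀ A : ℕ, A ≤ k → ∀ m : ℕ,
      (α : ℂ) * ((q : ℂ) ^ A * x i) ≠ ((q : ℂ) ^ m)⁻¹)
    (F : (Fin N → ℂ) → ℂ) :
    ((Dop q n)^[k]
        (fun w =>
          (∏ i ∈ Finset.univ.filter (fun i : Fin N => (i : ℕ) < n),
            (qPochInfC q ((α : ℂ) * w i))⁻¹) * F w)) x
      = (∏ i ∈ Finset.univ.filter (fun i : Fin N => (i : ℕ) < n),
          (qPochInfC q ((α : ℂ) * x i))⁻¹)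
        * Atilde q (-((α : ℂ) * x ⟨n - 1, by omega⟩)) n k F x := by
  rw [iterate_Dop_prod_inv_qPochInfC_mul hq α n F k x, iterate_conjDop hq ⟨n - 1, by omega⟩
    (Nat.sub_add_cancel hn1) α k F x]
  · intro i j hij A B hA hB
    rcases lt_or_gt_of_ne hij with h | h
    · exact hx i j h A B hA hB
    · exact (hx j i h B A hB hA).symm
  · intro i hi m h
    refine hne i hi 0 (Nat.zero_le _) m ?_
    rw [pow_zero, one_mul]
    exact eq_inv_of_mul_eq_one_right h
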